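/- Let G be a discrete group acting minimally and continuously on a compact Hausdorff space X, and let A be a simple unital C*-algebra equipped with a G-action by *-automorphisms σ. Then C(X,A), with the diagonal G-action (s·f)(x) = σ_s(f(s⁻¹·x)), is G-simple: its only G-invariant closed two-sided ideals are {0} and C(X,A). -/

import Mathlib

theorem MonoidHom.starAlgHom_leftInv {G A : Type*} [Group G] [CStarAlgebra A]
    (σ : G →* (A →⋆ₐ[ℂ] A)) (g : G) (a : A) : σ g⁻¹ (σ g a) = a := by
  have h : σ g⁻¹ * σ g = 1 := by rw [← map_mul, inv_mul_cancel, map_one]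
  calc σ g⁻¹ (σ g a) = (σ g⁻¹ * σ g) a := rfl
    _ = a := by rw [h]; rfl

theorem MonoidHom.starAlgHom_continuous {G A : Type*} [Group G] [CStarAlgebra A]
    (σ : G →* (A →⋆ₐ[ℂ] A)) (g : G) : Continuous (σ g) :=
  (NonUnitalStarAlgHom.isometry (σ g)
    (Function.LeftInverse.injective (MonoidHom.starAlgHom_leftInv σ g))).continuous

/-- The diagonal action of `G` on `C(X,A)`: `(s • f) x = σ_s (f (s⁻¹ • x))`. -/
noncomputable def diagAct {G X A : Type*} [Group G] [TopologicalSpace X]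
    [MulAction G X] [CStarAlgebra A] (hc : ∀ s : G, Continuous fun x : X => s • x)
    (σ : G →* (A →⋆ₐ[ℂ] A)) (s : G) (f : C(X, A)) : C(X, A) :=
  ⟨fun x => σ s (f (s⁻¹ • x)),
    (MonoidHom.starAlgHom_continuous σ s).comp (f.continuous.comp (hc s⁻¹))⟩

/- STATEMENT 10: If `G` acts minimally on the compact Hausdorff space `X` and `A` is a
simple unital C*-algebra with a `G`-action, then `C(X,A)` with the diagonal action is
`G`-simple: its only `G`-invariant closed two-sided ideals are `{0}` and everything. -/
theorem gSimple_of_minimal_and_simple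
    {G X A : Type*} [Group G] [TopologicalSpace X] [CompactSpace X] [T2Space X]
    [MulAction G X] (hc : ∀ s : G, Continuous fun x : X => s • x)
    (hmin : ∀ x : X, Dense {y : X | ∃ s : G, y = s • x})
    [CStarAlgebra A] [Nontrivial A]
    (hsimple : ∀ I : Set A, IsClosed I → (0 : A) ∈ I →
      (∀ a ∈ I, ∀ b ∈ I, a + b ∈ I) → (∀ a ∈ I, ∀ b : A, a * b ∈ I ∧ b * a ∈ I) →
      I = {0} ∨ I = Set.univ)
    (σ : G →* (A →⋆ₐ[ℂ] A)) :
    ∀ I : Set C(X, A), IsClosed I → (0 : C(X, A)) ∈ I →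
      (∀ f ∈ I, ∀ g ∈ I, f + g ∈ I) →
      (∀ f ∈ I, ∀ g : C(X, A), f * g ∈ I ∧ g * f ∈ I) →
      (∀ s : G, ∀ f ∈ I, diagAct hc σ s f ∈ I) →
      I = {0} ∨ I = Set.univ := by
  intro I hIc hI0 hIadd hImul hIact
  by_cases hI : I = {0}
  · exact Or.inl hI
  right
  obtain ⟨f, hfI, hf0⟩ : ∃ f ∈ I, f ≠ 0 := by
    by_contra! h
    exact hI (Set.Subset.antisymm (fun f hf => h f hf)
      (by rintro f rfl; exact hI0))
  obtain ⟨x₀, hx₀⟩ : ∃ x, f x ≠ 0 := by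
    by_contra! h
    exact hf0 (ContinuousMap.ext h)
  -- at every point some element of `I` is nonzero
  have hne : ∀ x : X, ∃ h ∈ I, h x ≠ 0 := by
    intro x
    have hU : IsOpen {y : X | f y ≠ 0} := isOpen_ne_fun f.continuous continuous_const
    obtain ⟨y, hy, s, rfl⟩ := (hmin x).exists_mem_open hU ⟨x₀, hx₀⟩ |>.imp
      fun y h => And.intro h.2 h.1
    refine ⟨_, hIact s⁻¹ f hfI, ?_⟩
    have hval : diagAct hc σ s⁻¹ f x = σ s⁻¹ (f (s • x)) := by simp [diagAct]
    rw [hval]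
    intro h0
    apply hy
    have := MonoidHom.starAlgHom_leftInv σ s⁻¹ (f (s • x))
    rw [h0, map_zero] at this
    exact this.symm
  -- the evaluations of `I` at every point are dense
  have hdense : ∀ x : X, closure ((fun h : C(X, A) => h x) '' I) = Set.univ := by
    intro x
    have hadd : ∀ a ∈ closure ((fun h : C(X, A) => h x) '' I), ∀ b ∈ closure ((fun h : C(X, A) => h x) '' I),
        a + b ∈ closure ((fun h : C(X, A) => h x) '' I) := by
      intro a ha b hb
      refine map_mem_closure₂ continuous_add ha hb ?_
      rintro _ ⟨g, hg, rfl⟩ _ ⟨k, hk, rfl⟩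
      exact ⟨g + k, hIadd g hg k hk, rfl⟩
    have hmul : ∀ a ∈ closure ((fun h : C(X, A) => h x) '' I), ∀ b : A,
        a * b ∈ closure ((fun h : C(X, A) => h x) '' I) ∧
        b * a ∈ closure ((fun h : C(X, A) => h x) '' I) := by
      intro a ha b
      constructor
      · refine map_mem_closure (f := fun a => a * b) (by fun_prop) ha ?_
        rintro _ ⟨g, hg, rfl⟩
        exact ⟨g * ContinuousMap.const X b, (hImul g hg _).1, rfl⟩
      · refine map_mem_closure (f := fun a => b * a) (by fun_prop) ha ?_
        rintro _ ⟨g, hg, rfl⟩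
        exact ⟨ContinuousMap.const X b * g, (hImul g hg _).2, rfl⟩
    rcases hsimple (closure ((fun h : C(X, A) => h x) '' I)) isClosed_closure
      (subset_closure ⟨0, hI0, rfl⟩) hadd hmul with h | h
    · obtain ⟨g, hg, hgx⟩ := hne x
      have : g x ∈ closure ((fun h : C(X, A) => h x) '' I) := subset_closure ⟨g, hg, rfl⟩
      rw [h] at this
      exact absurd this hgx
    · exact h
  have hone : (1 : C(X, A)) ∈ I := by
    rw [← hIc.closure_eq, Metric.mem_closure_iff]
    intro ε hε
    have hloc : ∀ x : X, ∃ h ∈ I, h x ∈ Metric.ball (1 : A) ε := by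
      intro x
      have h1 : (1 : A) ∈ closure ((fun h : C(X, A) => h x) '' I) := by
        rw [hdense x]; trivial
      obtain ⟨_, ⟨h, hh, rfl⟩, hd⟩ := Metric.mem_closure_iff.1 h1 ε hε
      exact ⟨h, hh, by rw [Metric.mem_ball, dist_comm]; exact hd⟩
    choose h hhI hhx using hloc
    have hUo : ∀ x : X, IsOpen ((h x) ⁻¹' Metric.ball (1 : A) ε) := fun x =>
      Metric.isOpen_ball.preimage (h x).continuous
    obtain ⟨t, ht⟩ := isCompact_univ.elim_finite_subcover
      (fun x : X => (h x) ⁻¹' Metric.ball (1 : A) ε) hUo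
      (fun x _ => Set.mem_iUnion.2 ⟨x, hhx x⟩)
    obtain ⟨ρ, hρ⟩ := PartitionOfUnity.exists_isSubordinate (ι := t) isClosed_univ
      (fun i => (h i) ⁻¹' Metric.ball (1 : A) ε) (fun i => hUo i) (by
        intro x hx
        obtain ⟨i, hi, hxi⟩ := Set.mem_iUnion₂.1 (ht hx)
        exact Set.mem_iUnion.2 ⟨⟨i, hi⟩, hxi⟩)
    let e : t → C(X, A) := fun i => ⟨fun x => ρ i x • (1 : A), by fun_prop⟩
    refine ⟨∑ i : t, e i * h i, ?_, ?_⟩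
    · exact Finset.sum_induction _ (· ∈ I) (fun a b ha hb => hIadd a ha b hb) hI0
        (fun i _ => (hImul _ (hhI i) _).2)
    · rw [ContinuousMap.dist_lt_iff hε]
      intro x
      have key := ρ.finsum_smul_mem_convex (x := x) (Set.mem_univ x)
        (g := fun i y => h i y) (t := Metric.ball (1 : A) ε)
        (fun i hi => hρ i (subset_tsupport _ hi)) (convex_ball _ _)
      rw [finsum_eq_sum_of_fintype, Metric.mem_ball, dist_comm] at key
      simpa [e, ContinuousMap.sum_apply] using key
  refine Set.eq_univ_of_forall fun g => ?_
  simpa using (hImul 1 hone g).1
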